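/- arXiv:2209.10539 — 2 statements merged into one kernel-verified Lean document; each statement's English description precedes it below -/
import Mathlib

section
/- Let G = (S, A) be a unit matrix hypergraph with sampling probabilities p_i ∈ (0,1], and let d̂ be the modified distance. Then for all x ∈ ℝ^n and all a ≥ 0, the convex hull of the ball B_d̂(x, a) is contained in B_d̂(x, √40 · a). -/
open Finset Matrix Real MeasureTheory
open scoped Classical

/-- `gval A T x = max_{j ∈ T} |⟨a_j, x⟩|`, where `a_j` are the rows of `A`. -/
noncomputable def gval {m n : ℕ} (A : Matrix (Fin m) (Fin n) ℝ) (T : Finset (Fin m))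
    (x : Fin n → ℝ) : ℝ :=
  if h : T.Nonempty then T.sup' h (fun j => |A j ⬝ᵥ x|) else 0

/-- The modified distance
`d̂(x,y) = (Σ_i 1_{p_i ≠ 1} p_i⁻¹ (g_i(x) + g_i(y))² g_i(x-y)²)^{1/2}`. -/
noncomputable def dHat {m n k : ℕ} (A : Matrix (Fin m) (Fin n) ℝ)
    (S : Fin k → Finset (Fin m)) (p : Fin k → ℝ) (x y : Fin n → ℝ) : ℝ :=
  Real.sqrt (∑ i, (if p i = 1 then 0 else (p i)⁻¹) *
    (gval A (S i) x + gval A (S i) y) ^ 2 * (gval A (S i) (x - y)) ^ 2)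

theorem abs_dotProduct_le_gval {m n : ℕ} (A : Matrix (Fin m) (Fin n) ℝ) {T : Finset (Fin m)}
    {j : Fin m} (hj : j ∈ T) (x : Fin n → ℝ) : |A j ⬝ᵥ x| ≤ gval A T x := by
  rw [gval, dif_pos ⟨j, hj⟩]
  exact Finset.le_sup' (fun j => |A j ⬝ᵥ x|) hj

theorem gval_le {m n : ℕ} {A : Matrix (Fin m) (Fin n) ℝ} {T : Finset (Fin m)} {x : Fin n → ℝ}
    {b : ℝ} (hb : 0 ≤ b) (h : ∀ j ∈ T, |A j ⬝ᵥ x| ≤ b) : gval A T x ≤ b := by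
  unfold gval
  split_ifs with hT
  · exact Finset.sup'_le hT _ h
  · exact hb

theorem gval_nonneg {m n : ℕ} (A : Matrix (Fin m) (Fin n) ℝ) (T : Finset (Fin m))
    (x : Fin n → ℝ) : 0 ≤ gval A T x := by
  rcases T.eq_empty_or_nonempty with rfl | ⟨j, hj⟩
  · simp [gval]
  · exact (abs_nonneg _).trans (abs_dotProduct_le_gval A hj x)

/-- The function `gval A T` as a seminorm. -/
noncomputable def gvalSeminorm {m n : ℕ} (A : Matrix (Fin m) (Fin n) ℝ) (T : Finset (Fin m)) :
    Seminorm ℝ (Fin n → ℝ) :=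
  Seminorm.ofSMulLE (gval A T)
    (le_antisymm (gval_le le_rfl fun j _ => by simp) (gval_nonneg A T 0))
    (fun x y => gval_le (add_nonneg (gval_nonneg A T x) (gval_nonneg A T y)) fun j hj => by
      rw [dotProduct_add]
      exact (abs_add_le _ _).trans
        (add_le_add (abs_dotProduct_le_gval A hj x) (abs_dotProduct_le_gval A hj y)))
    (fun r x => gval_le (mul_nonneg (norm_nonneg r) (gval_nonneg A T x)) fun j hj => by
      rw [dotProduct_smul, smul_eq_mul, abs_mul, Real.norm_eq_abs]
      exact mul_le_mul_of_nonneg_left (abs_dotProduct_le_gval A hj x) (abs_nonneg r))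

theorem gval_sub_le {m n : ℕ} (A : Matrix (Fin m) (Fin n) ℝ) (T : Finset (Fin m))
    (x y : Fin n → ℝ) : gval A T (x - y) ≤ gval A T x + gval A T y :=
  map_sub_le_add (gvalSeminorm A T) x y

theorem gval_le_add_gval_sub {m n : ℕ} (A : Matrix (Fin m) (Fin n) ℝ) (T : Finset (Fin m))
    (x y : Fin n → ℝ) : gval A T y ≤ gval A T x + gval A T (x - y) := by
  simpa using gval_sub_le A T x (x - y)

theorem convexOn_gval_sub {m n : ℕ} (A : Matrix (Fin m) (Fin n) ℝ) (T : Finset (Fin m))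
    (x : Fin n → ℝ) : ConvexOn ℝ Set.univ fun y => gval A T (x - y) :=
  (gvalSeminorm A T).convexOn.comp_affineMap
    (AffineMap.const ℝ (Fin n → ℝ) x - AffineMap.id ℝ (Fin n → ℝ))

/-- A function convex in `y` that agrees with `dHat A S p x y ^ 2` up to a factor of `3` in both
directions. -/
noncomputable def convexProxy {m n k : ℕ} (A : Matrix (Fin m) (Fin n) ℝ)
    (S : Fin k → Finset (Fin m)) (p : Fin k → ℝ) (x y : Fin n → ℝ) : ℝ :=
  ∑ i, (if p i = 1 then 0 else (p i)⁻¹) *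
    (2 * gval A (S i) x ^ 2 * gval A (S i) (x - y) ^ 2 + gval A (S i) (x - y) ^ 4)

theorem weight_nonneg {q : ℝ} (hq : 0 < q) : 0 ≤ if q = 1 then 0 else q⁻¹ := by
  split_ifs <;> positivity

theorem dHat_sq {m n k : ℕ} (A : Matrix (Fin m) (Fin n) ℝ) (S : Fin k → Finset (Fin m))
    {p : Fin k → ℝ} (hp : ∀ i, 0 < p i) (x y : Fin n → ℝ) :
    dHat A S p x y ^ 2 = ∑ i, (if p i = 1 then 0 else (p i)⁻¹) *
      (gval A (S i) x + gval A (S i) y) ^ 2 * (gval A (S i) (x - y)) ^ 2 :=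
  Real.sq_sqrt <| Finset.sum_nonneg fun i _ =>
    mul_nonneg (mul_nonneg (weight_nonneg (hp i)) (sq_nonneg _)) (sq_nonneg _)

theorem convexOn_convexProxy {m n k : ℕ} (A : Matrix (Fin m) (Fin n) ℝ)
    (S : Fin k → Finset (Fin m)) {p : Fin k → ℝ} (hp : ∀ i, 0 < p i) (x : Fin n → ℝ) :
    ConvexOn ℝ Set.univ (convexProxy A S p x) := by
  have hsum : convexProxy A S p x = ∑ i, fun y => (if p i = 1 then 0 else (p i)⁻¹) *
      (2 * gval A (S i) x ^ 2 * gval A (S i) (x - y) ^ 2 + gval A (S i) (x - y) ^ 4) := by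
    ext y
    simp only [convexProxy, Finset.sum_apply]
  rw [hsum]
  refine Finset.sum_induction _ (ConvexOn ℝ Set.univ) (fun _ _ => ConvexOn.add)
    (convexOn_const 0 convex_univ) fun i _ => ?_
  have hpow (r : ℕ) : ConvexOn ℝ Set.univ fun y => gval A (S i) (x - y) ^ r :=
    (convexOn_gval_sub A (S i) x).pow (fun y _ => gval_nonneg A (S i) (x - y)) r
  exact (((hpow 2).smul (by positivity : 0 ≤ 2 * gval A (S i) x ^ 2)).add (hpow 4)).smul
    (weight_nonneg (hp i))

theorem convexProxy_le {m n k : ℕ} (A : Matrix (Fin m) (Fin n) ℝ) (S : Fin k → Finset (Fin m))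
    {p : Fin k → ℝ} (hp : ∀ i, 0 < p i) (x y : Fin n → ℝ) :
    convexProxy A S p x y ≤ 3 * dHat A S p x y ^ 2 := by
  rw [dHat_sq A S hp, convexProxy, Finset.mul_sum]
  refine Finset.sum_le_sum fun i _ => ?_
  have hx := gval_nonneg A (S i) x
  have hy := gval_nonneg A (S i) y
  have hd := gval_nonneg A (S i) (x - y)
  have hdx := gval_sub_le A (S i) x y
  generalize gval A (S i) x = u at *
  generalize gval A (S i) y = w at *
  generalize gval A (S i) (x - y) = t at *
  have hu : u ^ 2 ≤ (u + w) ^ 2 := by gcongr; linarith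
  have ht : t ^ 2 ≤ (u + w) ^ 2 := by gcongr
  calc _ ≤ _ * (3 * (u + w) ^ 2 * t ^ 2) :=
        mul_le_mul_of_nonneg_left (by nlinarith [sq_nonneg t]) (weight_nonneg (hp i))
    _ = _ := by ring

theorem dHat_sq_le {m n k : ℕ} (A : Matrix (Fin m) (Fin n) ℝ) (S : Fin k → Finset (Fin m))
    {p : Fin k → ℝ} (hp : ∀ i, 0 < p i) (x y : Fin n → ℝ) :
    dHat A S p x y ^ 2 ≤ 3 * convexProxy A S p x y := by
  rw [dHat_sq A S hp, convexProxy, Finset.mul_sum]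
  refine Finset.sum_le_sum fun i _ => ?_
  have hx := gval_nonneg A (S i) x
  have hy := gval_nonneg A (S i) y
  have hyd := gval_le_add_gval_sub A (S i) x y
  generalize gval A (S i) x = u at *
  generalize gval A (S i) y = w at *
  generalize gval A (S i) (x - y) = t at *
  have hw : (u + w) ^ 2 ≤ (2 * u + t) ^ 2 := by gcongr ?_ ^ 2; linarith
  have hut : (u + w) ^ 2 ≤ 3 * (2 * u ^ 2 + t ^ 2) := by nlinarith [sq_nonneg (u - t)]
  calc _ = _ * ((u + w) ^ 2 * t ^ 2) := by ring
    _ ≤ _ * (3 * (2 * u ^ 2 + t ^ 2) * t ^ 2) := mul_le_mul_of_nonneg_left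
        (mul_le_mul_of_nonneg_right hut (sq_nonneg t)) (weight_nonneg (hp i))
    _ = _ := by ring

theorem stmt_15 {m n k : ℕ} (A : Matrix (Fin m) (Fin n) ℝ)
    (S : Fin k → Finset (Fin m))
    -- `S` is a partition of `[m]` into nonempty groups
    (hS : ∀ i, (S i).Nonempty)
    (hdisj : ∀ i j, i ≠ j → Disjoint (S i) (S j))
    (hcover : ∀ a : Fin m, ∃ i, a ∈ S i)
    -- sampling probabilities
    (p : Fin k → ℝ) (hp : ∀ i, 0 < p i ∧ p i ≤ 1)
    (x : Fin n → ℝ) (a : ℝ) (ha : 0 ≤ a) :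
    convexHull ℝ {y : Fin n → ℝ | dHat A S p x y ≤ a} ⊆
      {y : Fin n → ℝ | dHat A S p x y ≤ Real.sqrt 40 * a} := by
  have hpos i := (hp i).1
  have hsub : convexHull ℝ {y : Fin n → ℝ | dHat A S p x y ≤ a} ⊆
      {y | y ∈ Set.univ ∧ convexProxy A S p x y ≤ 3 * a ^ 2} := by
    refine convexHull_min (fun y hy => ⟨trivial, ?_⟩)
      ((convexOn_convexProxy A S hpos x).convex_le _)
    have hsq : dHat A S p x y ^ 2 ≤ a ^ 2 := pow_le_pow_left₀ (Real.sqrt_nonneg _) hy 2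
    linarith [convexProxy_le A S hpos x y]
  intro y hy
  have hb : 0 ≤ √40 * a := by positivity
  suffices h : dHat A S p x y ^ 2 ≤ (√40 * a) ^ 2 from
    le_of_abs_le (abs_le_of_sq_le_sq h hb)
  rw [mul_pow, Real.sq_sqrt (by norm_num : (0 : ℝ) ≤ 40)]
  linarith [dHat_sq_le A S hpos x y, (hsub hy).2, sq_nonneg a]
end

section
/- Let G = (S, A) be a unit matrix hypergraph with sampling probabilities p_i ∈ (0,1], let d̂ be the modified distance, and fix z ∈ ℝ^n. For x, y ∈ ℝ^n define d̂_z(x,y) = Σ_{i∈[k]} 1_{p_i≠1} p_i^{-1} g_i(x−y)² g_i(z)² and d̂^∞(x,y) = max_{i∈[k]} 1_{p_i≠1} p_i^{-1} g_i(x−y)². Then for all x, y ∈ ℝ^n: d̂(x, y)² ≤ 3 · d̂^∞(x,y) · Σ_{i∈[k]} (g_i(y) − g_i(z))² + 3 · d̂^∞(x,y) · Σ_{i∈[k]} (g_i(x) − g_i(z))² + 12 · d̂_z(x,y). -/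
open Finset Matrix Real MeasureTheory
open scoped Classical

theorem stmt_18 {m n k : ℕ} (A : Matrix (Fin m) (Fin n) ℝ)
    (S : Fin k → Finset (Fin m))
    -- `S` is a partition of `[m]` into nonempty groups
    (hS : ∀ i, (S i).Nonempty)
    (hdisj : ∀ i j, i ≠ j → Disjoint (S i) (S j))
    (hcover : ∀ a : Fin m, ∃ i, a ∈ S i)
    -- sampling probabilities
    (p : Fin k → ℝ) (hp : ∀ i, 0 < p i ∧ p i ≤ 1)
    (z x y : Fin n → ℝ) :
    (dHat A S p x y) ^ 2 ≤
      3 * (⨆ i : Fin k, (if p i = 1 then 0 else (p i)⁻¹) * (gval A (S i) (x - y)) ^ 2) *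
          (∑ i, (gval A (S i) y - gval A (S i) z) ^ 2) +
        3 * (⨆ i : Fin k, (if p i = 1 then 0 else (p i)⁻¹) * (gval A (S i) (x - y)) ^ 2) *
          (∑ i, (gval A (S i) x - gval A (S i) z) ^ 2) +
        12 * (∑ i, (if p i = 1 then 0 else (p i)⁻¹) *
          (gval A (S i) (x - y)) ^ 2 * (gval A (S i) z) ^ 2) := by
  have hw : ∀ i, 0 ≤ (if p i = 1 then 0 else (p i)⁻¹) := fun i => by
    split_ifs
    · exact le_rfl
    · exact inv_nonneg.2 (hp i).1.le
  unfold dHat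
  rw [Real.sq_sqrt (Finset.sum_nonneg fun i _ =>
    mul_nonneg (mul_nonneg (hw i) (sq_nonneg _)) (sq_nonneg _))]
  simp only [Finset.mul_sum, ← Finset.sum_add_distrib]
  refine Finset.sum_le_sum fun i _ => ?_
  have hM := le_ciSup (Set.finite_range fun i : Fin k =>
    (if p i = 1 then 0 else (p i)⁻¹) * (gval A (S i) (x - y)) ^ 2).bddAbove i
  have hwi := mul_nonneg (hw i) (sq_nonneg (gval A (S i) (x - y)))
  generalize (⨆ i : Fin k, (if p i = 1 then 0 else (p i)⁻¹) *
    (gval A (S i) (x - y)) ^ 2) = M at hM ⊢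
  generalize (if p i = 1 then 0 else (p i)⁻¹) = w at hM hwi ⊢
  generalize gval A (S i) (x - y) = d at hM hwi ⊢
  generalize gval A (S i) x = a
  generalize gval A (S i) y = b
  generalize gval A (S i) z = c
  have h : (a + b) ^ 2 ≤ 3 * ((b - c) ^ 2 + (a - c) ^ 2) + 12 * c ^ 2 := by
    nlinarith [sq_nonneg (a - b), sq_nonneg (a - 3 * c), sq_nonneg (b - 3 * c)]
  calc w * (a + b) ^ 2 * d ^ 2 = w * d ^ 2 * (a + b) ^ 2 := by ring
    _ ≤ w * d ^ 2 * (3 * ((b - c) ^ 2 + (a - c) ^ 2) + 12 * c ^ 2) := by gcongr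
    _ = w * d ^ 2 * (3 * ((b - c) ^ 2 + (a - c) ^ 2)) + 12 * (w * d ^ 2 * c ^ 2) := by ring
    _ ≤ M * (3 * ((b - c) ^ 2 + (a - c) ^ 2)) + 12 * (w * d ^ 2 * c ^ 2) := by gcongr
    _ = 3 * M * (b - c) ^ 2 + 3 * M * (a - c) ^ 2 + 12 * (w * d ^ 2 * c ^ 2) := by ring
end
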